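/- arXiv:1507.01995 — 7 statements merged into one kernel-verified Lean document; each statement's English description precedes it below -/
import Mathlib

section
/- The function F : ℝ² → ℝ defined by F(x,y) = γ([x,y]) (i.e., F(x,y) = ∫_x^y φ(t) dt when x ≤ y and F(x,y) = 0 when x > y) is log-concave: for all points p, q ∈ ℝ² and all λ ∈ (0,1), F(λp + (1−λ)q) ≥ F(p)^λ · F(q)^{1−λ}. -/
open MeasureTheory ProbabilityTheory Set

/-- The standard Gaussian measure of the interval `[x, y]` (equal to `∫_x^y φ(t) dt` when
`x ≤ y`, and `0` when `x > y`, since then the interval is empty). -/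
noncomputable def F (p : ℝ × ℝ) : ℝ := ((gaussianReal 0 1) (Set.Icc p.1 p.2)).toReal

/-- The standard Gaussian density satisfies `φ' = -t φ`. -/
lemma hasDerivAt_gaussianPDFReal_std (t : ℝ) :
    HasDerivAt (gaussianPDFReal 0 1) (-t * gaussianPDFReal 0 1 t) t := by
  have h : HasDerivAt (fun s : ℝ => (√(2 * Real.pi * ((1 : NNReal) : ℝ)))⁻¹ *
      Real.exp (-(s - 0) ^ 2 / (2 * ((1 : NNReal) : ℝ)))) _ t :=
    (((((hasDerivAt_id t).sub_const 0).pow 2).neg.div_const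
      (2 * ((1 : NNReal) : ℝ))).exp).const_mul _
  refine h.congr_deriv ?_
  simp only [gaussianPDFReal, id, NNReal.coe_one, Pi.neg_apply, Pi.pow_apply]
  push_cast
  ring

/-- A primitive of the standard Gaussian density. -/
lemma hasDerivAt_integral_gaussianPDFReal_std (t : ℝ) :
    HasDerivAt (fun u => ∫ s in (0 : ℝ)..u, gaussianPDFReal 0 1 s) (gaussianPDFReal 0 1 t) t := by
  have hc : Continuous (gaussianPDFReal 0 1) :=
    continuous_iff_continuousAt.2 fun s => (hasDerivAt_gaussianPDFReal_std s).continuousAt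
  exact intervalIntegral.integral_hasDerivAt_right (hc.intervalIntegrable _ _)
    hc.stronglyMeasurable.stronglyMeasurableAtFilter hc.continuousAt

lemma F_eq_sub {x y : ℝ} (h : x ≤ y) :
    F (x, y) = (∫ s in (0 : ℝ)..y, gaussianPDFReal 0 1 s) -
      ∫ s in (0 : ℝ)..x, gaussianPDFReal 0 1 s := by
  have hi : ∀ a b : ℝ, IntervalIntegrable (gaussianPDFReal 0 1) volume a b :=
    fun a b => (integrable_gaussianPDFReal 0 1).intervalIntegrable
  rw [intervalIntegral.integral_interval_sub_left (hi _ _) (hi _ _),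
    intervalIntegral.integral_of_le h, F, gaussianReal_apply_eq_integral 0 one_ne_zero,
    ENNReal.toReal_ofReal (integral_nonneg fun s => gaussianPDFReal_nonneg 0 1 s),
    integral_Icc_eq_integral_Ioc]

lemma F_eq_zero {p : ℝ × ℝ} (h : p.2 ≤ p.1) : F p = 0 := by
  have : gaussianReal 0 1 (Icc p.1 p.2) ≤ 0 := by
    have := nullSingletonClass_gaussianReal (μ := 0) (v := 1) one_ne_zero
    exact (measure_mono (Icc_subset_Icc_right h)).trans (by simp)
  simp [F, nonpos_iff_eq_zero.1 this]

/-- The second-order inequality `D D'' ≤ (D')²` for `D = Φ y - Φ x` along the direction `(a, b)`,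
where `Φ' = φ` and `φ' = -t φ`. -/
lemma mul_deriv2_le_sq_deriv {φ Φ : ℝ → ℝ} (hpos : ∀ t, 0 < φ t)
    (hφ : ∀ t, HasDerivAt φ (-t * φ t) t) (hΦ : ∀ t, HasDerivAt Φ (φ t) t)
    {x y : ℝ} (hxy : x ≤ y) (hD : 0 < Φ y - Φ x) (a b : ℝ) :
    (a ^ 2 * (x * φ x) - b ^ 2 * (y * φ y)) * (Φ y - Φ x) ≤ (b * φ y - a * φ x) ^ 2 := by
  set c : ℝ := (b * φ y - a * φ x) / (Φ y - Φ x) with hc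
  have hcD : c * (Φ y - Φ x) = b * φ y - a * φ x := div_mul_cancel₀ _ hD.ne'
  set w : ℝ → ℝ := fun t => a * φ x + c * (Φ t - Φ x) with hw
  have hwd : ∀ t, HasDerivAt w (c * φ t) t := fun t =>
    (((hΦ t).sub_const (Φ x)).const_mul c).const_add (a * φ x)
  have hmono : Monotone fun t => w t ^ 2 * t / φ t + c ^ 2 * Φ t := by
    refine monotone_of_hasDerivAt_nonneg
      (f' := fun t => ((c * φ t + w t * t) ^ 2 + w t ^ 2) / φ t) (fun t => ?_) (fun t => ?_)
    · refine (((((hwd t).pow 2).mul (hasDerivAt_id t)).div (hφ t) (hpos t).ne').add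
        ((hΦ t).const_mul (c ^ 2))).congr_deriv ?_
      have := (hpos t).ne'
      simp only [id, Pi.mul_apply, Pi.pow_apply]
      field_simp
      push_cast
      ring
    · have := hpos t
      simp only [Pi.zero_apply]
      positivity
  have h := hmono hxy
  have hwx : w x = a * φ x := by simp [hw]
  have hwy : w y = b * φ y := by simp only [hw]; rw [hcD]; ring
  have ex : w x ^ 2 * x / φ x = a ^ 2 * (x * φ x) := by
    have := (hpos x).ne'
    rw [hwx]; field_simp
  have ey : w y ^ 2 * y / φ y = b ^ 2 * (y * φ y) := by
    have := (hpos y).ne'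
    rw [hwy]; field_simp
  simp only [ex, ey] at h
  rw [← hcD]
  nlinarith [mul_le_mul_of_nonneg_right h hD.le]

/-- Concavity of `s ↦ log (Φ (y + s b) - Φ (x + s a))` on `[0, 1]`. -/
lemma concaveOn_log_sub_comp_line {φ Φ : ℝ → ℝ} (hpos : ∀ t, 0 < φ t)
    (hφ : ∀ t, HasDerivAt φ (-t * φ t) t) (hΦ : ∀ t, HasDerivAt Φ (φ t) t)
    {x y a b : ℝ} (hlt : ∀ s ∈ Icc (0 : ℝ) 1, x + s * a < y + s * b) :
    ConcaveOn ℝ (Icc 0 1) fun s => Real.log (Φ (y + s * b) - Φ (x + s * a)) := by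
  have hmono : StrictMono Φ := strictMono_of_hasDerivAt_pos hΦ hpos
  have hD : ∀ s ∈ Icc (0 : ℝ) 1, 0 < Φ (y + s * b) - Φ (x + s * a) :=
    fun s hs => sub_pos.2 (hmono (hlt s hs))
  have hline : ∀ u v s : ℝ, HasDerivAt (fun s => u + s * v) v s := fun u v s =>
    (((hasDerivAt_id s).mul_const v).const_add u).congr_deriv (one_mul v)
  have hd1 : ∀ s, HasDerivAt (fun s => Φ (y + s * b) - Φ (x + s * a))
      (φ (y + s * b) * b - φ (x + s * a) * a) s := fun s =>
    ((hΦ _).comp s (hline y b s)).sub ((hΦ _).comp s (hline x a s))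
  have hd2 : ∀ s, HasDerivAt (fun s => φ (y + s * b) * b - φ (x + s * a) * a)
      (-(y + s * b) * φ (y + s * b) * b * b - -(x + s * a) * φ (x + s * a) * a * a) s := fun s =>
    (((hφ _).comp s (hline y b s)).mul_const b).sub (((hφ _).comp s (hline x a s)).mul_const a)
  refine concaveOn_of_hasDerivWithinAt2_nonpos (convex_Icc 0 1)
    (fun s hs => ((hd1 s).log (hD s hs).ne').continuousAt.continuousWithinAt)
    (fun s hs => ((hd1 s).log (hD s (interior_subset hs)).ne').hasDerivWithinAt)
    (fun s hs => ((hd2 s).div (hd1 s) (hD s (interior_subset hs)).ne').hasDerivWithinAt)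
    (fun s hs => ?_)
  have hs' := interior_subset hs
  have key := mul_deriv2_le_sq_deriv hpos hφ hΦ (hlt s hs').le (hD s hs') a b
  refine div_nonpos_of_nonpos_of_nonneg ?_ (sq_nonneg _)
  linarith

/-- The function `F(x,y) = γ([x,y])` is log-concave. -/
theorem stmt0 :
    ∀ p q : ℝ × ℝ, ∀ l : ℝ, l ∈ Set.Ioo (0 : ℝ) 1 →
      F (l • p + (1 - l) • q) ≥ F p ^ l * F q ^ (1 - l) := by
  rintro ⟨x, y⟩ ⟨x', y'⟩ l ⟨hl0, hl1⟩
  have hFnn : ∀ r, 0 ≤ F r := fun r => ENNReal.toReal_nonneg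
  rcases le_or_gt y x with h | h
  · rw [F_eq_zero (p := (x, y)) h, Real.zero_rpow hl0.ne', zero_mul]
    exact hFnn _
  rcases le_or_gt y' x' with h' | h'
  · rw [F_eq_zero (p := (x', y')) h', Real.zero_rpow (sub_pos.2 hl1).ne', mul_zero]
    exact hFnn _
  have hpos : ∀ t, 0 < gaussianPDFReal 0 1 t := fun t => gaussianPDFReal_pos 0 1 t one_ne_zero
  have hmono := strictMono_of_hasDerivAt_pos hasDerivAt_integral_gaussianPDFReal_std hpos
  have hFpos : ∀ {u v : ℝ}, u < v → 0 < F (u, v) := fun huv => by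
    rw [F_eq_sub huv.le]
    exact sub_pos.2 (hmono huv)
  have hlt : ∀ s ∈ Icc (0 : ℝ) 1, x' + s * (x - x') < y' + s * (y - y') := by
    rintro s ⟨hs0, hs1⟩
    rcases hs0.eq_or_lt with rfl | hs0
    · simpa using h'
    · nlinarith [mul_pos hs0 (sub_pos.2 h), mul_nonneg (sub_nonneg.2 hs1) (sub_pos.2 h').le]
  have hconc := (concaveOn_log_sub_comp_line hpos hasDerivAt_gaussianPDFReal_std
    hasDerivAt_integral_gaussianPDFReal_std hlt).2 (right_mem_Icc.2 zero_le_one)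
    (left_mem_Icc.2 zero_le_one) hl0.le (sub_pos.2 hl1).le (by ring)
  have hltl := hlt l ⟨hl0.le, hl1.le⟩
  have hpt : l • (x, y) + (1 - l) • (x', y') = (x' + l * (x - x'), y' + l * (y - y')) := by
    ext <;> simp <;> ring
  simp only [smul_eq_mul, mul_one, mul_zero, add_zero, one_mul, zero_mul,
    add_sub_cancel] at hconc
  rw [← F_eq_sub h.le, ← F_eq_sub h'.le, ← F_eq_sub hltl.le] at hconc
  rw [hpt, ge_iff_le, Real.rpow_def_of_pos (hFpos h), Real.rpow_def_of_pos (hFpos h'),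
    ← Real.exp_add, ← Real.le_log_iff_exp_le (hFpos hltl)]
  linarith
end

section
/- For every ε ∈ (0,1), the set S_ε = {(x,y) ∈ ℝ² : Φ(y) − Φ(x) ≥ 1 − ε} is a convex subset of ℝ². -/
open MeasureTheory ProbabilityTheory Set

/-- The standard Gaussian CDF. -/
noncomputable def Phi (t : ℝ) : ℝ := ((gaussianReal 0 1) (Set.Iic t)).toReal

lemma Phi_mono : Monotone Phi := fun _ _ h =>
  measureReal_mono (μ := gaussianReal 0 1) (Iic_subset_Iic.2 h)

lemma continuous_gaussianPDFReal_zero_one : Continuous (gaussianPDFReal 0 1) := by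
  unfold gaussianPDFReal
  fun_prop

lemma Phi_eq_integral (y : ℝ) : Phi y = ∫ t in Iic y, gaussianPDFReal 0 1 t := by
  rw [Phi, gaussianReal_apply_eq_integral 0 one_ne_zero,
    ENNReal.toReal_ofReal (setIntegral_nonneg measurableSet_Iic
      fun t _ => gaussianPDFReal_nonneg 0 1 t)]

lemma hasDerivAt_Phi (y : ℝ) : HasDerivAt Phi (gaussianPDFReal 0 1 y) y := by
  have h : Phi = fun y => Phi 0 + ∫ t in (0 : ℝ)..y, gaussianPDFReal 0 1 t := by
    ext y
    rw [Phi_eq_integral, Phi_eq_integral, ← intervalIntegral.integral_Iic_sub_Iic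
      (integrable_gaussianPDFReal 0 1).integrableOn (integrable_gaussianPDFReal 0 1).integrableOn]
    ring
  rw [h]
  exact (continuous_gaussianPDFReal_zero_one.integral_hasStrictDerivAt 0 y).hasDerivAt.const_add _

lemma gaussianPDFReal_zero_one_eq_mul (x y : ℝ) :
    gaussianPDFReal 0 1 x = gaussianPDFReal 0 1 y * Real.exp ((y ^ 2 - x ^ 2) / 2) := by
  simp only [gaussianPDFReal, mul_assoc, ← Real.exp_add]
  congr 2
  simp
  ring

/-- Along an increasing segment above the diagonal, the derivative of the Gaussian measure of
`[x, y]` cannot change from negative to positive. -/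
lemma not_deriv_neg_and_deriv_pos {c d x y s : ℝ} (hc : 0 < c) (hd : 0 < d) (hs : 0 < s)
    (h₁ : x < y) (h₂ : x + s * d < y + s * c)
    (hneg : gaussianPDFReal 0 1 y * c < gaussianPDFReal 0 1 x * d)
    (hpos : gaussianPDFReal 0 1 (x + s * d) * d < gaussianPDFReal 0 1 (y + s * c) * c) :
    False := by
  rw [gaussianPDFReal_zero_one_eq_mul x y, mul_assoc,
    mul_lt_mul_iff_right₀ (gaussianPDFReal_pos 0 1 _ one_ne_zero)] at hneg
  rw [gaussianPDFReal_zero_one_eq_mul (x + s * d) (y + s * c), mul_assoc,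
    mul_lt_mul_iff_right₀ (gaussianPDFReal_pos 0 1 _ one_ne_zero)] at hpos
  have hlt := Real.exp_lt_exp.1 (lt_of_mul_lt_mul_right (hpos.trans hneg) hd.le)
  have hsc := mul_pos hs hc
  have hsd := mul_pos hs hd
  rcases le_or_gt d c with hdc | hcd
  · have h := Real.one_lt_exp_iff.1 (lt_of_mul_lt_mul_right
      (by linarith : 1 * d < Real.exp ((y ^ 2 - x ^ 2) / 2) * d) hd.le)
    have hsum : 0 < x + y := pos_of_mul_pos_right (by linarith : 0 < (y - x) * (x + y))
      (by linarith)
    have := mul_le_mul_of_nonneg_left hdc hs.le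
    nlinarith [mul_nonneg (sub_nonneg.2 this) hsum.le, mul_pos (add_pos hsc hsd) (sub_pos.2 h₂)]
  · have h := Real.exp_lt_one_iff.1 (lt_of_mul_lt_mul_right
      (by linarith : Real.exp (((y + s * c) ^ 2 - (x + s * d) ^ 2) / 2) * d < 1 * d) hd.le)
    have hsum : x + s * d + (y + s * c) < 0 := by
      by_contra! hge
      nlinarith [mul_nonneg (sub_pos.2 h₂).le hge]
    have := mul_lt_mul_of_pos_left hcd hs
    nlinarith [mul_pos (sub_pos.2 this) (neg_pos.2 hsum), mul_pos (add_pos hsc hsd) (sub_pos.2 h₁)]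

/-- For every `ε ∈ (0,1)`, the set `S_ε = {(x,y) : Φ(y) − Φ(x) ≥ 1 − ε}` is convex. -/
theorem stmt1 (ε : ℝ) (hε : ε ∈ Set.Ioo (0 : ℝ) 1) :
    Convex ℝ {p : ℝ × ℝ | Phi p.2 - Phi p.1 ≥ 1 - ε} := by
  rintro ⟨x, y⟩ hp ⟨x', y'⟩ hq a b ha hb hab
  simp only [mem_ofPred_eq, ge_iff_le] at hp hq
  have lt_of {u v : ℝ} (h : 1 - ε ≤ Phi v - Phi u) : u < v :=
    Phi_mono.reflect_lt (by linarith [hε.2])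
  have h₁ := lt_of hp
  have h₂ := lt_of hq
  obtain rfl | ha := ha.eq_or_lt
  · simp_all
  obtain rfl | hb := hb.eq_or_lt
  · simp_all
  obtain rfl : a = 1 - b := by linarith
  set c := y' - y with hc
  set d := x' - x with hd
  have hlt {t : ℝ} (h0 : 0 < t) (h1 : t < 1) : x + t * d < y + t * c := by
    nlinarith [mul_pos h0 (sub_pos.2 h₂), mul_pos (sub_pos.2 h1) (sub_pos.2 h₁)]
  let g : ℝ → ℝ := fun t => Phi (y + t * c) - Phi (x + t * d)
  let g' : ℝ → ℝ := fun t =>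
    gaussianPDFReal 0 1 (y + t * c) * c - gaussianPDFReal 0 1 (x + t * d) * d
  have hg (t : ℝ) : HasDerivAt g (g' t) t := by
    have haff (u v : ℝ) : HasDerivAt (fun t => u + t * v) v t := by
      simpa using ((hasDerivAt_id t).mul_const v).const_add u
    exact ((hasDerivAt_Phi _).comp t (haff y c)).sub ((hasDerivAt_Phi _).comp t (haff x d))
  have hcont : Continuous g := continuous_iff_continuousAt.2 fun t => (hg t).continuousAt
  have hg0 : 1 - ε ≤ g 0 := by simpa [g] using hp
  have hg1 : 1 - ε ≤ g 1 := by simpa [g, hc, hd] using hq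
  suffices 1 - ε ≤ g b by
    have e₁ : (1 - b) * x + b * x' = x + b * d := by rw [hd]; ring
    have e₂ : (1 - b) * y + b * y' = y + b * c := by rw [hc]; ring
    simpa [e₁, e₂, g] using this
  by_contra! hgb
  obtain ⟨t₁, ⟨h01, h1b⟩, hd₁⟩ := exists_hasDerivAt_eq_slope g g' hb hcont.continuousOn
    fun t _ => hg t
  obtain ⟨t₂, ⟨hb2, h21⟩, hd₂⟩ := exists_hasDerivAt_eq_slope g g' (by linarith : b < 1)
    hcont.continuousOn fun t _ => hg t
  have hneg : g' t₁ < 0 := hd₁ ▸ div_neg_of_neg_of_pos (by linarith) (by linarith)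
  have hpos : 0 < g' t₂ := hd₂ ▸ div_pos (by linarith) (by linarith)
  simp only [g', sub_neg, sub_pos] at hneg hpos
  have hφ (u : ℝ) := gaussianPDFReal_nonneg 0 1 u
  have hl₁ := hlt h01 (by linarith)
  have hl₂ := hlt (by linarith) h21
  rcases le_or_gt c 0 with hc0 | hc0 <;> rcases le_or_gt d 0 with hd0 | hd0
  · rcases hc0.eq_or_lt with hc0 | hc0
    · linarith [mul_eq_zero_of_right (gaussianPDFReal 0 1 (y + t₁ * c)) hc0,
        mul_nonneg (hφ (x + t₁ * d)) (neg_nonneg.2 hd0)]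
    rcases hd0.eq_or_lt with hd0 | hd0
    · linarith [mul_nonneg (hφ (y + t₂ * c)) (neg_nonneg.2 hc0.le),
        mul_eq_zero_of_right (gaussianPDFReal 0 1 (x + t₂ * d)) hd0]
    have e₁ : x + t₁ * d = x + t₂ * d + (t₂ - t₁) * -d := by ring
    have e₂ : y + t₁ * c = y + t₂ * c + (t₂ - t₁) * -c := by ring
    rw [e₁, e₂] at hneg hl₁
    exact not_deriv_neg_and_deriv_pos (neg_pos.2 hc0) (neg_pos.2 hd0) (by linarith) hl₂ hl₁
      (by linarith) (by linarith)
  · linarith [mul_nonneg (hφ (y + t₂ * c)) (neg_nonneg.2 hc0), mul_nonneg (hφ (x + t₂ * d)) hd0.le]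
  · linarith [mul_nonneg (hφ (y + t₁ * c)) hc0.le,
      mul_nonneg (hφ (x + t₁ * d)) (neg_nonneg.2 hd0)]
  · have e₁ : x + t₂ * d = x + t₁ * d + (t₂ - t₁) * d := by ring
    have e₂ : y + t₂ * c = y + t₁ * c + (t₂ - t₁) * c := by ring
    rw [e₁, e₂] at hpos hl₂
    exact not_deriv_neg_and_deriv_pos hc0 hd0 (by linarith) hl₁ hl₂ hneg hpos
end

section
/- Let n ≥ 1 and 0 < ε ≤ 1/2. The set C = {(a,b,x) ∈ ℝ × ℝ × ℝⁿ : μ_n({ξ ∈ ℝⁿ : a ≤ xᵀξ ≤ b}) ≥ 1 − ε} (the two-sided Gaussian linear chance constraint set P(a ≤ xᵀξ ≤ b) ≥ 1−ε) is convex. -/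
open MeasureTheory ProbabilityTheory Set

/-- The law of a vector of `n` i.i.d. standard Gaussian random variables. -/
noncomputable def stdGaussianPi (n : ℕ) : Measure (Fin n → ℝ) :=
  Measure.pi fun _ => gaussianReal 0 1

/-- A linear functional of a standard Gaussian vector is distributed as `‖x‖` times a standard
Gaussian variable. -/
lemma stdGaussianPi_map_sum (n : ℕ) (x : Fin n → ℝ) :
    (stdGaussianPi n).map (fun ξ => ∑ i, x i * ξ i) =
      (gaussianReal 0 1).map (fun z => ‖WithLp.toLp 2 x‖ * z) := by
  set y : EuclideanSpace ℝ (Fin n) := WithLp.toLp 2 x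
  have hcomp : (fun ξ : Fin n → ℝ => ∑ i, x i * ξ i) = innerSL ℝ y ∘ WithLp.toLp 2 := by
    ext ξ
    simp [y, PiLp.inner_apply, mul_comm]
  rw [hcomp, ← Measure.map_map (by fun_prop) (by fun_prop), stdGaussianPi, map_pi_eq_stdGaussian,
    IsGaussian.map_eq_gaussianReal, integral_strongDual_stdGaussian, variance_dual_stdGaussian,
    gaussianReal_map_const_mul, innerSL_apply_norm]
  congr 1
  · simp
  · ext
    simp

lemma stdGaussianPi_real_slab (n : ℕ) (a b : ℝ) (x : Fin n → ℝ) :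
    ((stdGaussianPi n) {ξ | a ≤ ∑ i, x i * ξ i ∧ ∑ i, x i * ξ i ≤ b}).toReal =
      (gaussianReal 0 1).real {z | a ≤ ‖WithLp.toLp 2 x‖ * z ∧ ‖WithLp.toLp 2 x‖ * z ≤ b} := by
  have h := congrArg (fun μ : Measure ℝ => μ (Icc a b)) (stdGaussianPi_map_sum n x)
  beta_reduce at h
  rw [Measure.map_apply (by fun_prop) measurableSet_Icc,
    Measure.map_apply (by fun_prop) measurableSet_Icc] at h
  exact congrArg ENNReal.toReal h

/-- The standard Gaussian mass between `0` and `t`, counted negatively for `t < 0`. -/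
noncomputable def gaussianPrimitive (t : ℝ) : ℝ := ∫ z in (0 : ℝ)..t, gaussianPDFReal 0 1 z

lemma hasDerivAt_gaussianPrimitive (t : ℝ) :
    HasDerivAt gaussianPrimitive (gaussianPDFReal 0 1 t) t :=
  (continuous_gaussianPDFReal_zero_one.integral_hasStrictDerivAt 0 t).hasDerivAt

lemma strictMono_gaussianPrimitive : StrictMono gaussianPrimitive := by
  refine strictMono_of_deriv_pos fun t => ?_
  rw [(hasDerivAt_gaussianPrimitive t).deriv]
  exact gaussianPDFReal_pos 0 1 t one_ne_zero

lemma gaussianPrimitive_neg (t : ℝ) : gaussianPrimitive (-t) = -gaussianPrimitive t := by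
  have h := intervalIntegral.integral_comp_neg (a := 0) (b := t) (gaussianPDFReal 0 1)
  have heven : ∀ z, gaussianPDFReal 0 1 (-z) = gaussianPDFReal 0 1 z := by
    simp [gaussianPDFReal]
  simp only [heven, neg_zero] at h
  rw [gaussianPrimitive, gaussianPrimitive, h, ← intervalIntegral.integral_symm]

lemma concaveOn_gaussianPrimitive : ConcaveOn ℝ (Ici 0) gaussianPrimitive := by
  refine AntitoneOn.concaveOn_of_deriv (convex_Ici 0)
    (fun t _ => (hasDerivAt_gaussianPrimitive t).continuousAt.continuousWithinAt)
    (fun t _ => (hasDerivAt_gaussianPrimitive t).differentiableAt.differentiableWithinAt) ?_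
  intro s hs t _ hst
  rw [interior_Ici, mem_Ioi] at hs
  rw [(hasDerivAt_gaussianPrimitive s).deriv, (hasDerivAt_gaussianPrimitive t).deriv]
  simp only [gaussianPDFReal, sub_zero]
  gcongr

lemma gaussianReal_real_Icc {a b : ℝ} (hab : a ≤ b) :
    (gaussianReal 0 1).real (Icc a b) = gaussianPrimitive b - gaussianPrimitive a := by
  rw [measureReal_def, gaussianReal_apply_eq_integral 0 one_ne_zero, ENNReal.toReal_ofReal
    (setIntegral_nonneg measurableSet_Icc fun z _ => gaussianPDFReal_nonneg 0 1 z),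
    integral_Icc_eq_integral_Ioc, ← intervalIntegral.integral_of_le hab]
  exact (intervalIntegral.integral_interval_sub_left
    (continuous_gaussianPDFReal_zero_one.intervalIntegrable _ _)
    (continuous_gaussianPDFReal_zero_one.intervalIntegrable _ _)).symm

lemma gaussianPrimitive_le_half (t : ℝ) : gaussianPrimitive t ≤ 1 / 2 := by
  have hmono : gaussianPrimitive t ≤ gaussianPrimitive |t| :=
    strictMono_gaussianPrimitive.monotone (le_abs_self t)
  have h := gaussianReal_real_Icc (neg_le_self (abs_nonneg t))
  rw [gaussianPrimitive_neg] at h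
  linarith [measureReal_le_one (μ := gaussianReal 0 1) (s := Icc (-|t|) |t|)]

lemma gaussianPrimitive_zero : gaussianPrimitive 0 = 0 := intervalIntegral.integral_same

/-- The probability that `σ` times a standard Gaussian variable lies in `[a, b]`. -/
noncomputable def scaledGaussianMass (a b σ : ℝ) : ℝ :=
  (gaussianReal 0 1).real {z | a ≤ σ * z ∧ σ * z ≤ b}

lemma scaledGaussianMass_of_pos {a b σ : ℝ} (hσ : 0 < σ) (hab : a ≤ b) :
    scaledGaussianMass a b σ = gaussianPrimitive (b / σ) - gaussianPrimitive (a / σ) := by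
  rw [← gaussianReal_real_Icc (by gcongr), scaledGaussianMass]
  congr 1
  ext z
  simp only [mem_ofPred_eq, mem_Icc]
  rw [div_le_iff₀' hσ, le_div_iff₀' hσ]

lemma scaledGaussianMass_mono {a b σ a' b' σ' : ℝ}
    (h : ∀ z, a ≤ σ * z → σ * z ≤ b → a' ≤ σ' * z ∧ σ' * z ≤ b') :
    scaledGaussianMass a b σ ≤ scaledGaussianMass a' b' σ' :=
  measureReal_mono fun z hz => h z hz.1 hz.2

/-- An interval of mass at least one half under a centred Gaussian contains the centre. -/
lemma nonpos_nonneg_of_half_le_scaledGaussianMass {a b σ : ℝ} (hσ : 0 ≤ σ)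
    (h : 1 / 2 ≤ scaledGaussianMass a b σ) : a ≤ 0 ∧ 0 ≤ b := by
  have hne : {z | a ≤ σ * z ∧ σ * z ≤ b}.Nonempty := by
    by_contra hempty
    rw [not_nonempty_iff_eq_empty] at hempty
    rw [scaledGaussianMass, hempty, measureReal_empty] at h
    norm_num at h
  obtain ⟨z, hza, hzb⟩ := hne
  rcases hσ.eq_or_lt with rfl | hσ
  · simpa using And.intro hza hzb
  rw [scaledGaussianMass_of_pos hσ (hza.trans hzb)] at h
  constructor <;> by_contra! hlt
  · have := strictMono_gaussianPrimitive (div_pos hlt hσ)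
    rw [gaussianPrimitive_zero] at this
    linarith [gaussianPrimitive_le_half (b / σ)]
  · have := strictMono_gaussianPrimitive (div_neg_of_neg_of_pos hlt hσ)
    rw [gaussianPrimitive_zero] at this
    have hneg := gaussianPrimitive_le_half (-(a / σ))
    rw [gaussianPrimitive_neg] at hneg
    linarith

lemma scaledGaussianMass_antitone_scale {a b σ τ : ℝ} (hσ : 0 ≤ σ) (hστ : σ ≤ τ) (ha : a ≤ 0)
    (hb : 0 ≤ b) : scaledGaussianMass a b τ ≤ scaledGaussianMass a b σ := by
  refine scaledGaussianMass_mono fun z hza hzb => ?_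
  rcases le_total 0 z with hz | hz
  · exact ⟨ha.trans (mul_nonneg hσ hz), (mul_le_mul_of_nonneg_right hστ hz).trans hzb⟩
  · exact ⟨hza.trans (mul_le_mul_of_nonpos_right hστ hz),
      (mul_nonpos_of_nonneg_of_nonpos hσ hz).trans hb⟩

/-- The perspective of the concave function `gaussianPrimitive` is concave. -/
lemma gaussianPrimitive_perspective {s t b₁ b₂ σ₁ σ₂ : ℝ} (hs : 0 ≤ s) (ht : 0 ≤ t)
    (hσ₁ : 0 < σ₁) (hσ₂ : 0 < σ₂) (hpos : 0 < s * σ₁ + t * σ₂) (hb₁ : 0 ≤ b₁) (hb₂ : 0 ≤ b₂) :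
    s * σ₁ / (s * σ₁ + t * σ₂) * gaussianPrimitive (b₁ / σ₁) +
        t * σ₂ / (s * σ₁ + t * σ₂) * gaussianPrimitive (b₂ / σ₂) ≤
      gaussianPrimitive ((s * b₁ + t * b₂) / (s * σ₁ + t * σ₂)) := by
  have h := concaveOn_gaussianPrimitive.2 (mem_Ici.2 (div_nonneg hb₁ hσ₁.le))
    (mem_Ici.2 (div_nonneg hb₂ hσ₂.le))
    (div_nonneg (mul_nonneg hs hσ₁.le) hpos.le) (div_nonneg (mul_nonneg ht hσ₂.le) hpos.le)
    (by rw [← add_div, div_self hpos.ne'])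
  simp only [smul_eq_mul] at h
  have hcenter : s * σ₁ / (s * σ₁ + t * σ₂) * (b₁ / σ₁) +
      t * σ₂ / (s * σ₁ + t * σ₂) * (b₂ / σ₂) = (s * b₁ + t * b₂) / (s * σ₁ + t * σ₂) := by
    field_simp
  rwa [hcenter] at h

lemma le_scaledGaussianMass_convexCombination {s t a₁ b₁ σ₁ a₂ b₂ σ₂ c : ℝ} (hc : 1 / 2 ≤ c)
    (hs : 0 ≤ s) (ht : 0 ≤ t) (hst : s + t = 1) (hσ₁ : 0 ≤ σ₁) (hσ₂ : 0 ≤ σ₂)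
    (h₁ : c ≤ scaledGaussianMass a₁ b₁ σ₁) (h₂ : c ≤ scaledGaussianMass a₂ b₂ σ₂) :
    c ≤ scaledGaussianMass (s * a₁ + t * a₂) (s * b₁ + t * b₂) (s * σ₁ + t * σ₂) := by
  obtain ⟨ha₁, hb₁⟩ := nonpos_nonneg_of_half_le_scaledGaussianMass hσ₁ (hc.trans h₁)
  obtain ⟨ha₂, hb₂⟩ := nonpos_nonneg_of_half_le_scaledGaussianMass hσ₂ (hc.trans h₂)
  rcases hσ₁.eq_or_lt with rfl | hσ₁
  · refine h₂.trans (scaledGaussianMass_mono fun z hza hzb => ?_)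
    constructor <;> nlinarith [mul_nonneg hs hb₁, mul_nonpos_of_nonneg_of_nonpos hs ha₁,
      mul_le_mul_of_nonneg_left hza ht, mul_le_mul_of_nonneg_left hzb ht]
  rcases hσ₂.eq_or_lt with rfl | hσ₂
  · refine h₁.trans (scaledGaussianMass_mono fun z hza hzb => ?_)
    constructor <;> nlinarith [mul_nonneg ht hb₂, mul_nonpos_of_nonneg_of_nonpos ht ha₂,
      mul_le_mul_of_nonneg_left hza hs, mul_le_mul_of_nonneg_left hzb hs]
  have hpos : 0 < s * σ₁ + t * σ₂ := by
    rcases hs.eq_or_lt with rfl | hs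
    · have : t = 1 := by linarith
      simpa [this] using hσ₂
    · positivity
  rw [scaledGaussianMass_of_pos hσ₁ (ha₁.trans hb₁)] at h₁
  rw [scaledGaussianMass_of_pos hσ₂ (ha₂.trans hb₂)] at h₂
  rw [scaledGaussianMass_of_pos hpos (by gcongr <;> linarith)]
  have hupper := gaussianPrimitive_perspective hs ht hσ₁ hσ₂ hpos hb₁ hb₂
  have hlower := gaussianPrimitive_perspective hs ht hσ₁ hσ₂ hpos (neg_nonneg.2 ha₁)
    (neg_nonneg.2 ha₂)
  rw [show s * -a₁ + t * -a₂ = -(s * a₁ + t * a₂) by ring] at hlower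
  simp only [neg_div, gaussianPrimitive_neg] at hlower
  have hw : s * σ₁ / (s * σ₁ + t * σ₂) + t * σ₂ / (s * σ₁ + t * σ₂) = 1 := by
    rw [← add_div, div_self hpos.ne']
  have hw₁ : 0 ≤ s * σ₁ / (s * σ₁ + t * σ₂) := by positivity
  have hw₂ : 0 ≤ t * σ₂ / (s * σ₁ + t * σ₂) := by positivity
  have hc_comb : c = s * σ₁ / (s * σ₁ + t * σ₂) * c + t * σ₂ / (s * σ₁ + t * σ₂) * c := by
    rw [← add_mul, hw, one_mul]
  linarith [mul_le_mul_of_nonneg_left h₁ hw₁, mul_le_mul_of_nonneg_left h₂ hw₂]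

/-- The two-sided Gaussian linear chance constraint set
`{(a,b,x) : P(a ≤ xᵀξ ≤ b) ≥ 1 − ε}` is convex for `0 < ε ≤ 1/2`. -/
theorem stmt3 (n : ℕ) (hn : 1 ≤ n) (ε : ℝ) (hε0 : 0 < ε) (hε : ε ≤ 1 / 2) :
    Convex ℝ {p : ℝ × ℝ × (Fin n → ℝ) |
      ((stdGaussianPi n) {ξ : Fin n → ℝ |
        p.1 ≤ ∑ i, p.2.2 i * ξ i ∧ ∑ i, p.2.2 i * ξ i ≤ p.2.1}).toReal ≥ 1 - ε} := by
  rintro ⟨a₁, b₁, x⟩ h₁ ⟨a₂, b₂, y⟩ h₂ s t hs ht hst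
  simp only [mem_ofPred_eq, stdGaussianPi_real_slab, ge_iff_le, Prod.smul_mk, Prod.mk_add_mk,
    smul_eq_mul] at h₁ h₂ ⊢
  have hhalf : 1 / 2 ≤ 1 - ε := by linarith
  have hcomb := le_scaledGaussianMass_convexCombination hhalf hs ht hst
    (norm_nonneg (WithLp.toLp 2 x)) (norm_nonneg (WithLp.toLp 2 y)) h₁ h₂
  obtain ⟨ha, hb⟩ := nonpos_nonneg_of_half_le_scaledGaussianMass (by positivity)
    (hhalf.trans hcomb)
  refine hcomb.trans (scaledGaussianMass_antitone_scale (norm_nonneg _) ?_ ha hb)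
  rw [WithLp.toLp_add, WithLp.toLp_smul, WithLp.toLp_smul]
  refine (norm_add_le _ _).trans_eq ?_
  rw [norm_smul_of_nonneg hs, norm_smul_of_nonneg ht]
end

section
/- Let n ≥ 1, 0 < ε ≤ 1/2, let μ ∈ ℝⁿ, and let L be any n × n real matrix. The set {(a,b,x) ∈ ℝ × ℝ × ℝⁿ : μ_n({ζ ∈ ℝⁿ : |xᵀ(Lζ + μ) + a| ≤ b}) ≥ 1 − ε} is convex. (This is the absolute-value Gaussian chance constraint P(|xᵀξ + a| ≤ b) ≥ 1−ε for ξ = Lζ + μ jointly Gaussian with mean μ and covariance LLᵀ.) -/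
open MeasureTheory ProbabilityTheory Set

/-- The standard Gaussian mass of the (oriented) interval from `0` to `t`. -/
noncomputable def gaussianIntegral (t : ℝ) : ℝ :=
  ∫ x in (0 : ℝ)..t, gaussianPDFReal 0 1 x

lemma continuous_gaussianPDFReal (m : ℝ) (v : NNReal) : Continuous (gaussianPDFReal m v) := by
  rw [gaussianPDFReal_def]
  fun_prop

lemma hasDerivAt_gaussianIntegral (t : ℝ) :
    HasDerivAt gaussianIntegral (gaussianPDFReal 0 1 t) t :=
  ((continuous_gaussianPDFReal 0 1).integral_hasStrictDerivAt 0 t).hasDerivAt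

lemma strictMono_gaussianIntegral : StrictMono gaussianIntegral :=
  strictMono_of_deriv_pos fun t => by
    rw [(hasDerivAt_gaussianIntegral t).deriv]
    exact gaussianPDFReal_pos 0 1 t one_ne_zero

lemma gaussianIntegral_zero : gaussianIntegral 0 = 0 := intervalIntegral.integral_same

lemma gaussianPDFReal_neg (v : NNReal) (t : ℝ) :
    gaussianPDFReal 0 v (-t) = gaussianPDFReal 0 v t := by
  simp [gaussianPDFReal]

lemma gaussianIntegral_neg (t : ℝ) : gaussianIntegral (-t) = -gaussianIntegral t := by
  have h := intervalIntegral.integral_comp_neg (a := 0) (b := t) (gaussianPDFReal 0 1)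
  simp only [gaussianPDFReal_neg, neg_zero] at h
  rw [gaussianIntegral, gaussianIntegral, h, intervalIntegral.integral_symm]

lemma concaveOn_gaussianIntegral : ConcaveOn ℝ (Ici 0) gaussianIntegral := by
  have hd : Differentiable ℝ gaussianIntegral := fun t =>
    (hasDerivAt_gaussianIntegral t).differentiableAt
  refine AntitoneOn.concaveOn_of_deriv (convex_Ici 0) hd.continuous.continuousOn
    hd.differentiableOn ?_
  rw [interior_Ici]
  intro x hx y _ hxy
  rw [(hasDerivAt_gaussianIntegral x).deriv, (hasDerivAt_gaussianIntegral y).deriv]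
  simp only [gaussianPDFReal]
  have hx' : (0 : ℝ) < x := hx
  gcongr

lemma gaussianReal_real_Icc_s6 {u v : ℝ} (h : -v ≤ u) :
    (gaussianReal 0 1 (Icc (-v) u)).toReal = gaussianIntegral u + gaussianIntegral v := by
  have hi : ∀ a b : ℝ, IntervalIntegrable (gaussianPDFReal 0 1) volume a b := fun a b =>
    (continuous_gaussianPDFReal 0 1).intervalIntegrable a b
  rw [gaussianReal_apply_eq_integral 0 one_ne_zero, ENNReal.toReal_ofReal
    (integral_nonneg (gaussianPDFReal_nonneg 0 1)), integral_Icc_eq_integral_Ioc,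
    ← intervalIntegral.integral_of_le h,
    ← intervalIntegral.integral_add_adjacent_intervals (hi (-v) 0) (hi 0 u),
    intervalIntegral.integral_symm]
  change -gaussianIntegral (-v) + gaussianIntegral u = _
  rw [gaussianIntegral_neg]
  ring

lemma gaussianIntegral_le_half (t : ℝ) : gaussianIntegral t ≤ 1 / 2 := by
  rcases le_or_gt 0 t with ht | ht
  · have h := gaussianReal_real_Icc_s6 (u := t) (v := t) (by linarith)
    have h1 : (gaussianReal 0 1 (Icc (-t) t)).toReal ≤ 1 := measureReal_le_one
    linarith
  · have := strictMono_gaussianIntegral ht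
    rw [gaussianIntegral_zero] at this
    linarith

/-- A pair of endpoints whose Gaussian masses add up to at least one half is nonnegative. -/
lemma nonneg_of_half_le_gaussianIntegral_add {u v : ℝ}
    (h : 1 / 2 ≤ gaussianIntegral u + gaussianIntegral v) : 0 ≤ u := by
  by_contra! hu
  have := strictMono_gaussianIntegral hu
  rw [gaussianIntegral_zero] at this
  linarith [gaussianIntegral_le_half v]

lemma le_gaussianReal_abs_le_iff {ε s m b : ℝ} (hε0 : 0 < ε) (hε : ε ≤ 1 / 2) (hs : 0 ≤ s) :
    1 - ε ≤ (gaussianReal 0 1 {z : ℝ | |s * z + m| ≤ b}).toReal ↔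
      0 ≤ b - m ∧ 0 ≤ b + m ∧
        (0 < s → 1 - ε ≤ gaussianIntegral ((b - m) / s) + gaussianIntegral ((b + m) / s)) := by
  rcases hs.eq_or_lt with rfl | hs
  · by_cases h : |m| ≤ b
    · simp only [zero_mul, zero_add, h, ofPred_true, measure_univ, ENNReal.toReal_one]
      rw [abs_le] at h
      exact ⟨fun _ => ⟨by linarith, by linarith, fun h0 => absurd h0 (lt_irrefl _)⟩,
        fun _ => by linarith⟩
    · simp only [zero_mul, zero_add, h, ofPred_false, measure_empty, ENNReal.toReal_zero]
      refine ⟨fun h0 => by linarith, fun h0 => absurd (abs_le.2 ⟨?_, ?_⟩) h⟩ <;>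
        linarith [h0.1, h0.2.1]
  · have hset : {z : ℝ | |s * z + m| ≤ b} = Icc (-((b + m) / s)) ((b - m) / s) := by
      ext z
      rw [mem_ofPred_eq, mem_Icc, abs_le, ← neg_div, div_le_iff₀ hs, le_div_iff₀ hs]
      constructor <;> rintro ⟨h1, h2⟩ <;> constructor <;> linarith
    rw [hset]
    by_cases h : -((b + m) / s) ≤ (b - m) / s
    · rw [gaussianReal_real_Icc_s6 h]
      refine ⟨fun h0 => ?_, fun h0 => h0.2.2 hs⟩
      have h1 := nonneg_of_half_le_gaussianIntegral_add
        (by linarith : 1 / 2 ≤ gaussianIntegral ((b - m) / s) + gaussianIntegral ((b + m) / s))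
      have h2 := nonneg_of_half_le_gaussianIntegral_add
        (by linarith : 1 / 2 ≤ gaussianIntegral ((b + m) / s) + gaussianIntegral ((b - m) / s))
      rw [le_div_iff₀ hs, zero_mul] at h1 h2
      exact ⟨h1, h2, fun _ => h0⟩
    · rw [Icc_eq_empty h, measure_empty, ENNReal.toReal_zero]
      refine ⟨fun h0 => by linarith, fun h0 => absurd ?_ h⟩
      have := div_nonneg h0.1 hs.le
      have := div_nonneg h0.2.1 hs.le
      linarith

/-- The perspective of a superlevel set of `gaussianIntegral u + gaussianIntegral v` in the
nonnegative quadrant is convex, and remains so after decreasing the scale `s`. -/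
lemma le_gaussianIntegral_div_add_of_convex_comb {δ c d s s₁ s₂ p₁ p₂ q₁ q₂ : ℝ}
    (hc : 0 ≤ c) (hd : 0 ≤ d) (hs : 0 < s) (hs₁ : 0 ≤ s₁) (hs₂ : 0 ≤ s₂)
    (hsle : s ≤ c * s₁ + d * s₂) (hp₁ : 0 ≤ p₁) (hp₂ : 0 ≤ p₂) (hq₁ : 0 ≤ q₁) (hq₂ : 0 ≤ q₂)
    (h₁ : 0 < s₁ → δ ≤ gaussianIntegral (p₁ / s₁) + gaussianIntegral (q₁ / s₁))
    (h₂ : 0 < s₂ → δ ≤ gaussianIntegral (p₂ / s₂) + gaussianIntegral (q₂ / s₂)) :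
    δ ≤ gaussianIntegral ((c * p₁ + d * p₂) / s) + gaussianIntegral ((c * q₁ + d * q₂) / s) := by
  have mono : Monotone gaussianIntegral := strictMono_gaussianIntegral.monotone
  have hS : 0 < c * s₁ + d * s₂ := hs.trans_le hsle
  suffices h : δ ≤ gaussianIntegral ((c * p₁ + d * p₂) / (c * s₁ + d * s₂)) +
      gaussianIntegral ((c * q₁ + d * q₂) / (c * s₁ + d * s₂)) by
    refine h.trans (add_le_add ?_ ?_) <;>
      exact mono (div_le_div_of_nonneg_left (by positivity) hs hsle)
  rcases hs₁.eq_or_lt with rfl | hs₁'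
  · have hd' : 0 < d := hd.lt_of_ne (by rintro rfl; simp at hS)
    have hs₂' : 0 < s₂ := hs₂.lt_of_ne (by rintro rfl; simp at hS)
    refine (h₂ hs₂').trans (add_le_add (mono ?_) (mono ?_)) <;>
    · rw [mul_zero, zero_add, div_le_div_iff₀ hs₂' (by positivity)]
      nlinarith [mul_nonneg (mul_nonneg hc hp₁) hs₂, mul_nonneg (mul_nonneg hc hq₁) hs₂]
  rcases hs₂.eq_or_lt with rfl | hs₂'
  · have hc' : 0 < c := hc.lt_of_ne (by rintro rfl; simp at hS)
    refine (h₁ hs₁').trans (add_le_add (mono ?_) (mono ?_)) <;>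
    · rw [mul_zero, add_zero, div_le_div_iff₀ hs₁' (by positivity)]
      nlinarith [mul_nonneg (mul_nonneg hd hp₂) hs₁, mul_nonneg (mul_nonneg hd hq₂) hs₁]
  set S := c * s₁ + d * s₂ with hSdef
  have hw₁ : 0 ≤ c * s₁ / S := by positivity
  have hw₂ : 0 ≤ d * s₂ / S := by positivity
  have hw : c * s₁ / S + d * s₂ / S = 1 := by rw [← add_div, div_self hS.ne']
  have comb : ∀ {r₁ r₂ : ℝ}, 0 ≤ r₁ → 0 ≤ r₂ →
      c * s₁ / S * gaussianIntegral (r₁ / s₁) + d * s₂ / S * gaussianIntegral (r₂ / s₂) ≤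
        gaussianIntegral ((c * r₁ + d * r₂) / S) := fun {r₁ r₂} hr₁ hr₂ => by
    have h := concaveOn_gaussianIntegral.2 (mem_Ici.2 (div_nonneg hr₁ hs₁))
      (mem_Ici.2 (div_nonneg hr₂ hs₂)) hw₁ hw₂ hw
    have e : c * s₁ / S * (r₁ / s₁) + d * s₂ / S * (r₂ / s₂) = (c * r₁ + d * r₂) / S := by
      field_simp
    simpa only [smul_eq_mul, e] using h
  have e₁ := mul_le_mul_of_nonneg_left (h₁ hs₁') hw₁
  have e₂ := mul_le_mul_of_nonneg_left (h₂ hs₂') hw₂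
  have e₃ : c * s₁ / S * δ + d * s₂ / S * δ = δ := by rw [← add_mul, hw, one_mul]
  linarith [comb hp₁ hp₂, comb hq₁ hq₂]

/-- A linear functional of a standard Gaussian vector is a centered Gaussian variable whose
standard deviation is the Euclidean norm of the functional. -/
lemma stdGaussianPi_map_dotProduct {n : ℕ} (w : Fin n → ℝ) :
    (stdGaussianPi n).map (fun ζ => w ⬝ᵥ ζ) =
      (gaussianReal 0 1).map (fun z => ‖WithLp.toLp 2 w‖ * z) := by
  let f : StrongDual ℝ (EuclideanSpace ℝ (Fin n)) := innerSL ℝ (WithLp.toLp 2 w)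
  have hf : (fun ζ : Fin n → ℝ => w ⬝ᵥ ζ) = f ∘ WithLp.toLp 2 := by
    ext ζ
    simp [f, PiLp.inner_apply, dotProduct, mul_comm]
  have hm : Measurable (WithLp.toLp 2 : (Fin n → ℝ) → EuclideanSpace ℝ (Fin n)) := by fun_prop
  rw [hf, ← Measure.map_map (by fun_prop) hm, stdGaussianPi, map_pi_eq_stdGaussian,
    IsGaussian.map_eq_gaussianReal, integral_strongDual_stdGaussian, variance_dual_stdGaussian,
    gaussianReal_map_const_mul]
  congr 1
  · simp
  · ext
    simp [f]

lemma stdGaussianPi_abs_dotProduct_add_le {n : ℕ} (w : Fin n → ℝ) (m b : ℝ) :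
    stdGaussianPi n {ζ | |w ⬝ᵥ ζ + m| ≤ b} =
      gaussianReal 0 1 {z | |‖WithLp.toLp 2 w‖ * z + m| ≤ b} := by
  have hs : MeasurableSet {y : ℝ | |y + m| ≤ b} :=
    measurableSet_le (by fun_prop) measurable_const
  have hw : Measurable fun ζ : Fin n → ℝ => w ⬝ᵥ ζ := by
    unfold dotProduct
    fun_prop
  have h := congrArg (fun ν => ν {y : ℝ | |y + m| ≤ b}) (stdGaussianPi_map_dotProduct w)
  rwa [Measure.map_apply hw hs, Measure.map_apply (by fun_prop) hs] at h

lemma le_stdGaussianPi_abs_affine_le_iff {n : ℕ} {ε : ℝ} (hε0 : 0 < ε) (hε : ε ≤ 1 / 2)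
    (μ : Fin n → ℝ) (L : Matrix (Fin n) (Fin n) ℝ) (a b : ℝ) (x : Fin n → ℝ) :
    1 - ε ≤ (stdGaussianPi n {ζ | |∑ i, x i * (L.mulVec ζ + μ) i + a| ≤ b}).toReal ↔
      0 ≤ b - (x ⬝ᵥ μ + a) ∧ 0 ≤ b + (x ⬝ᵥ μ + a) ∧ (0 < ‖WithLp.toLp 2 (L.vecMul x)‖ →
        1 - ε ≤ gaussianIntegral ((b - (x ⬝ᵥ μ + a)) / ‖WithLp.toLp 2 (L.vecMul x)‖) +
          gaussianIntegral ((b + (x ⬝ᵥ μ + a)) / ‖WithLp.toLp 2 (L.vecMul x)‖)) := by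
  have h : ∀ ζ, ∑ i, x i * (L.mulVec ζ + μ) i + a = L.vecMul x ⬝ᵥ ζ + (x ⬝ᵥ μ + a) := fun ζ => by
    rw [← Matrix.dotProduct_mulVec, ← add_assoc, ← dotProduct_add]
    rfl
  simp only [h]
  rw [stdGaussianPi_abs_dotProduct_add_le,
    le_gaussianReal_abs_le_iff hε0 hε (norm_nonneg (WithLp.toLp 2 (L.vecMul x)))]

/-- The absolute-value Gaussian chance constraint set
`{(a,b,x) : P(|xᵀ(Lζ + μ) + a| ≤ b) ≥ 1 − ε}` is convex. -/
theorem stmt6 (n : ℕ) (hn : 1 ≤ n) (ε : ℝ) (hε0 : 0 < ε) (hε : ε ≤ 1 / 2)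
    (μ : Fin n → ℝ) (L : Matrix (Fin n) (Fin n) ℝ) :
    Convex ℝ {p : ℝ × ℝ × (Fin n → ℝ) |
      ((stdGaussianPi n) {ζ : Fin n → ℝ |
        |∑ i, p.2.2 i * (L.mulVec ζ + μ) i + p.1| ≤ p.2.1}).toReal ≥ 1 - ε} := by
  rintro ⟨a₁, b₁, x₁⟩ h₁ ⟨a₂, b₂, x₂⟩ h₂ c d hc hd -
  simp only [mem_ofPred_eq, ge_iff_le, Prod.smul_mk, Prod.mk_add_mk, smul_eq_mul,
    le_stdGaussianPi_abs_affine_le_iff hε0 hε] at h₁ h₂ ⊢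
  obtain ⟨hp₁, hq₁, h₁⟩ := h₁
  obtain ⟨hp₂, hq₂, h₂⟩ := h₂
  have ep : c * b₁ + d * b₂ - ((c • x₁ + d • x₂) ⬝ᵥ μ + (c * a₁ + d * a₂)) =
      c * (b₁ - (x₁ ⬝ᵥ μ + a₁)) + d * (b₂ - (x₂ ⬝ᵥ μ + a₂)) := by
    simp only [add_dotProduct, smul_dotProduct, smul_eq_mul]
    ring
  have eq : c * b₁ + d * b₂ + ((c • x₁ + d • x₂) ⬝ᵥ μ + (c * a₁ + d * a₂)) =
      c * (b₁ + (x₁ ⬝ᵥ μ + a₁)) + d * (b₂ + (x₂ ⬝ᵥ μ + a₂)) := by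
    simp only [add_dotProduct, smul_dotProduct, smul_eq_mul]
    ring
  have hnorm : ‖WithLp.toLp 2 (L.vecMul (c • x₁ + d • x₂))‖ ≤
      c * ‖WithLp.toLp 2 (L.vecMul x₁)‖ + d * ‖WithLp.toLp 2 (L.vecMul x₂)‖ := by
    rw [Matrix.add_vecMul, Matrix.smul_vecMul, Matrix.smul_vecMul, WithLp.toLp_add,
      WithLp.toLp_smul, WithLp.toLp_smul]
    refine (norm_add_le _ _).trans_eq ?_
    rw [norm_smul, norm_smul, Real.norm_of_nonneg hc, Real.norm_of_nonneg hd]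
  rw [ep, eq]
  exact ⟨by positivity, by positivity, fun hs => le_gaussianIntegral_div_add_of_convex_comb hc hd hs
    (norm_nonneg _) (norm_nonneg _) hnorm hp₁ hp₂ hq₁ hq₂ h₁ h₂⟩
end

section
/- Let f : ℝ → ℝ be a convex function which attains its minimum at some point c ∈ ℝ, let g : ℝᵐ → ℝ be an arbitrary convex function, and let 0 < ε ≤ 1/2. Then the set D = {(x, z, b) ∈ ℝⁿ × ℝᵐ × ℝ : μ_n({ξ ∈ ℝⁿ : f(xᵀξ + b) + g(z) ≤ 0}) ≥ 1 − ε} is convex. -/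
open MeasureTheory ProbabilityTheory Set

/-- A linear form of a standard Gaussian vector has the law of a scaled standard Gaussian. -/
lemma stdGaussianPi_map_sum_mul {n : ℕ} (x : Fin n → ℝ) :
    (stdGaussianPi n).map (fun ξ => ∑ i, x i * ξ i) =
      (gaussianReal 0 1).map (fun t => ‖WithLp.toLp 2 x‖ * t) := by
  have hmeas : ∀ i, AEMeasurable (fun t : ℝ => x i * t) (gaussianReal 0 1) := fun i => by fun_prop
  have hlaw : ∀ i, (stdGaussianPi n).map (fun ξ => x i * ξ i) =
      (gaussianReal 0 1).map (fun t => x i * t) := fun i => by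
    rw [← (measurePreserving_eval (fun _ : Fin n => gaussianReal 0 1) i).map_eq,
      Measure.map_map (by fun_prop) (by fun_prop)]
    rfl
  have hind : iIndepFun (fun i ξ => x i * ξ i) (stdGaussianPi n) :=
    iIndepFun_pi (μ := fun _ : Fin n => gaussianReal 0 1) hmeas
  have : IsProbabilityMeasure (stdGaussianPi n) := by unfold stdGaussianPi; infer_instance
  refine Measure.ext_of_charFun ?_
  ext t
  have h := congrFun (hind.charFun_map_fun_sum_eq_prod
    (fun i => ((measurable_pi_apply i).const_mul (x i)).aemeasurable)) t
  rw [h, Finset.prod_apply]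
  simp_rw [hlaw, gaussianReal_map_const_mul, charFun_gaussianReal]
  rw [← Complex.exp_sum]
  congr 1
  have hn : (‖WithLp.toLp 2 x‖ ^ 2 : ℝ) = ∑ i, x i ^ 2 := by
    rw [EuclideanSpace.norm_sq_eq]; simp
  simp [← Complex.ofReal_pow, hn, Finset.sum_mul, Finset.sum_div]

/-- The standard Gaussian mass of `[0, t]` is concave in `t ≥ 0`. -/
lemma concaveOn_integral_gaussianPDFReal :
    ConcaveOn ℝ (Ici 0) (fun t => ∫ x in (0 : ℝ)..t, gaussianPDFReal 0 1 x) := by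
  have hcont : Continuous (gaussianPDFReal 0 1) := by
    unfold gaussianPDFReal; fun_prop
  have hd : ∀ t, HasDerivAt (fun t => ∫ x in (0 : ℝ)..t, gaussianPDFReal 0 1 x)
      (gaussianPDFReal 0 1 t) t := fun t =>
    intervalIntegral.integral_hasDerivAt_right (hcont.intervalIntegrable _ _)
      hcont.aestronglyMeasurable.stronglyMeasurableAtFilter hcont.continuousAt
  refine AntitoneOn.concaveOn_of_deriv (convex_Ici 0)
    (fun t _ => (hd t).continuousAt.continuousWithinAt)
    (fun t _ => (hd t).differentiableAt.differentiableWithinAt) ?_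
  intro a ha b hb hab
  simp only [interior_Ici, mem_Ioi] at ha hb
  rw [(hd a).deriv, (hd b).deriv, gaussianPDFReal, gaussianPDFReal]
  gcongr

lemma gaussianReal_real_Icc_s7 {s t : ℝ} (hs : 0 ≤ s) (ht : 0 ≤ t) :
    (gaussianReal 0 1).real (Icc (-s) t) =
      (∫ x in (0 : ℝ)..s, gaussianPDFReal 0 1 x) + ∫ x in (0 : ℝ)..t, gaussianPDFReal 0 1 x := by
  have hint : ∀ a b : ℝ, IntervalIntegrable (gaussianPDFReal 0 1) volume a b := fun a b =>
    (integrable_gaussianPDFReal 0 1).intervalIntegrable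
  have hneg : ∫ x in (-s)..0, gaussianPDFReal 0 1 x = ∫ x in (0 : ℝ)..s, gaussianPDFReal 0 1 x := by
    have h := intervalIntegral.integral_comp_neg (a := 0) (b := s) (gaussianPDFReal 0 1)
    rw [neg_zero] at h
    rw [← h]
    simp [gaussianPDFReal]
  rw [measureReal_def, gaussianReal_apply_eq_integral _ one_ne_zero,
    ENNReal.toReal_ofReal (integral_nonneg (gaussianPDFReal_nonneg _ _)),
    integral_Icc_eq_integral_Ioc, ← intervalIntegral.integral_of_le (by linarith), ← hneg,
    intervalIntegral.integral_add_adjacent_intervals (hint _ _) (hint _ _)]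

/-- A closed convex set containing `0` is approximated in Gaussian mass by compact intervals. -/
lemma exists_Icc_subset_gaussianReal_le {S : Set ℝ} (hS : IsClosed S) (hconv : Convex ℝ S)
    (h0 : (0 : ℝ) ∈ S) {δ : ℝ} (hδ : 0 < δ) :
    ∃ s t : ℝ, 0 ≤ s ∧ 0 ≤ t ∧ Icc (-s) t ⊆ S ∧
      (gaussianReal 0 1).real S ≤ (gaussianReal 0 1).real (Icc (-s) t) + δ := by
  have hmono : Monotone fun k : ℕ => S ∩ Icc (-(k : ℝ)) k := fun i j hij =>
    inter_subset_inter_right _ (Icc_subset_Icc (by simpa using hij) (by simpa using hij))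
  have hU : ⋃ k : ℕ, S ∩ Icc (-(k : ℝ)) k = S := by
    rw [← inter_iUnion]
    refine inter_eq_left.2 fun y _ => ?_
    obtain ⟨k, hk⟩ := exists_nat_ge |y|
    exact mem_iUnion.2 ⟨k, abs_le.1 hk⟩
  have hlim := tendsto_measure_iUnion_atTop (μ := gaussianReal 0 1) hmono
  rw [hU] at hlim
  have hlim' := (ENNReal.tendsto_toReal (measure_ne_top (gaussianReal 0 1) S)).comp hlim
  obtain ⟨k, hk⟩ := (hlim'.eventually (lt_mem_nhds
    (show (gaussianReal 0 1 S).toReal - δ < (gaussianReal 0 1 S).toReal by linarith))).exists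
  have hmem : (0 : ℝ) ∈ S ∩ Icc (-(k : ℝ)) k := ⟨h0, by simp⟩
  have heq := eq_Icc_of_connected_compact
    ⟨⟨0, hmem⟩, (hconv.inter (convex_Icc (-(k : ℝ)) k)).isPreconnected⟩
    (isCompact_Icc.inter_left hS)
  have hmem' := hmem
  rw [heq] at hmem'
  refine ⟨-sInf (S ∩ Icc (-(k : ℝ)) k), sSup (S ∩ Icc (-(k : ℝ)) k), by linarith [hmem'.1],
    hmem'.2, ?_, ?_⟩
  · rw [neg_neg, ← heq]
    exact inter_subset_left
  · rw [neg_neg, ← heq]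
    simp only [Function.comp] at hk
    simp only [measureReal_def]
    linarith

/-- Concavity of the standard Gaussian measure on closed intervals containing the origin. -/
lemma gaussianReal_real_ge_of_convex_comb {S₁ S₂ T : Set ℝ} (hS₁ : IsClosed S₁)
    (hS₂ : IsClosed S₂) (hc₁ : Convex ℝ S₁) (hc₂ : Convex ℝ S₂) (h₁ : (0 : ℝ) ∈ S₁)
    (h₂ : (0 : ℝ) ∈ S₂) {u v : ℝ} (hu : 0 ≤ u) (hv : 0 ≤ v) (huv : u + v = 1)
    (hTc : Convex ℝ T) (hT : ∀ y₁ ∈ S₁, ∀ y₂ ∈ S₂, u * y₁ + v * y₂ ∈ T) :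
    u * (gaussianReal 0 1).real S₁ + v * (gaussianReal 0 1).real S₂ ≤
      (gaussianReal 0 1).real T := by
  refine le_of_forall_pos_le_add fun δ hδ => ?_
  obtain ⟨s₁, t₁, hs₁, ht₁, hsub₁, hle₁⟩ := exists_Icc_subset_gaussianReal_le hS₁ hc₁ h₁ hδ
  obtain ⟨s₂, t₂, hs₂, ht₂, hsub₂, hle₂⟩ := exists_Icc_subset_gaussianReal_le hS₂ hc₂ h₂ hδ
  have hsub : Icc (-(u * s₁ + v * s₂)) (u * t₁ + v * t₂) ⊆ T := by
    have hl := hT (-s₁) (hsub₁ ⟨le_rfl, by linarith⟩) (-s₂) (hsub₂ ⟨le_rfl, by linarith⟩)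
    have hr := hT t₁ (hsub₁ ⟨by linarith, le_rfl⟩) t₂ (hsub₂ ⟨by linarith, le_rfl⟩)
    have := hTc.ordConnected.out hl hr
    rwa [show u * -s₁ + v * -s₂ = -(u * s₁ + v * s₂) by ring] at this
  have hm := measureReal_mono (μ := gaussianReal 0 1) hsub
  rw [gaussianReal_real_Icc_s7 (by positivity) (by positivity)] at hm
  rw [gaussianReal_real_Icc_s7 hs₁ ht₁] at hle₁
  rw [gaussianReal_real_Icc_s7 hs₂ ht₂] at hle₂
  have hs := concaveOn_integral_gaussianPDFReal.2 hs₁ hs₂ hu hv huv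
  have ht := concaveOn_integral_gaussianPDFReal.2 ht₁ ht₂ hu hv huv
  simp only [smul_eq_mul] at hs ht
  have e₁ := mul_le_mul_of_nonneg_left hle₁ hu
  have e₂ := mul_le_mul_of_nonneg_left hle₂ hv
  have e₃ : u * δ + v * δ = δ := by rw [← add_mul, huv, one_mul]
  linarith

/-- A closed convex set of standard Gaussian mass at least `1 / 2` contains the origin. -/
lemma zero_mem_of_half_le_gaussianReal {S : Set ℝ} (hS : IsClosed S) (hconv : Convex ℝ S)
    (h : 1 / 2 ≤ (gaussianReal 0 1).real S) : (0 : ℝ) ∈ S := by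
  by_contra h0
  have hdisj : Disjoint S (-S) := by
    refine disjoint_left.2 fun y hy hy' => h0 ?_
    have := hconv hy hy' (a := 1 / 2) (b := 1 / 2) (by norm_num) (by norm_num) (by norm_num)
    simpa using this
  have hneg : (gaussianReal 0 1).real (-S) = (gaussianReal 0 1).real S := by
    have hmap := gaussianReal_map_neg (μ := 0) (v := 1)
    rw [neg_zero] at hmap
    conv_rhs => rw [← hmap]
    rw [map_measureReal_apply measurable_neg hS.measurableSet]
    rfl
  have hopen : IsOpen (S ∪ -S)ᶜ := (hS.union hS.neg).isOpen_compl
  have hpos : 0 < (gaussianReal 0 1).real (S ∪ -S)ᶜ := by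
    refine ENNReal.toReal_pos (fun hz => ?_) (measure_ne_top _ _)
    exact (hopen.measure_pos volume ⟨0, by simpa using h0⟩).ne'
      (gaussianReal_absolutelyContinuous' 0 one_ne_zero hz)
  rw [probReal_compl_eq_one_sub (hS.union hS.neg).measurableSet,
    measureReal_union hdisj hS.neg.measurableSet, hneg] at hpos
  linarith

/-- If `f : ℝ → ℝ` is convex and attains its minimum at `c`, and `g : ℝᵐ → ℝ` is convex,
then the set `D = {(x,z,b) : P(f(xᵀξ + b) + g(z) ≤ 0) ≥ 1 − ε}` is convex. -/
theorem stmt7 (n m : ℕ) (ε : ℝ) (hε0 : 0 < ε) (hε : ε ≤ 1 / 2)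
    (f : ℝ → ℝ) (hf : ConvexOn ℝ Set.univ f) (c : ℝ) (hc : ∀ t : ℝ, f c ≤ f t)
    (g : (Fin m → ℝ) → ℝ) (hg : ConvexOn ℝ Set.univ g) :
    Convex ℝ {p : (Fin n → ℝ) × (Fin m → ℝ) × ℝ |
      ((stdGaussianPi n) {ξ : Fin n → ℝ |
        f (∑ i, p.1 i * ξ i + p.2.2) + g p.2.1 ≤ 0}).toReal ≥ 1 - ε} := by
  have hfc : Continuous f := by
    simpa [continuousOn_univ] using hf.continuousOn isOpen_univ
  let S : ℝ → (Fin m → ℝ) → ℝ → Set ℝ := fun σ z b => {t | f (σ * t + b) + g z ≤ 0}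
  have hSclosed : ∀ σ z b, IsClosed (S σ z b) := fun σ z b =>
    isClosed_le (by fun_prop) continuous_const
  have hjoint : ∀ {a b : ℝ}, 0 ≤ a → 0 ≤ b → a + b = 1 → ∀ {t₁ t₂ : ℝ} {z₁ z₂ : Fin m → ℝ},
      f t₁ + g z₁ ≤ 0 → f t₂ + g z₂ ≤ 0 → f (a * t₁ + b * t₂) + g (a • z₁ + b • z₂) ≤ 0 := by
    intro a b ha hb hab t₁ t₂ z₁ z₂ h₁ h₂
    have e₁ := hf.2 (mem_univ t₁) (mem_univ t₂) ha hb hab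
    have e₂ := hg.2 (mem_univ z₁) (mem_univ z₂) ha hb hab
    simp only [smul_eq_mul] at e₁ e₂
    nlinarith [mul_nonneg ha (neg_nonneg.2 h₁), mul_nonneg hb (neg_nonneg.2 h₂)]
  have hSconv : ∀ σ z b, Convex ℝ (S σ z b) := by
    intro σ z b t₁ h₁ t₂ h₂ u v hu hv huv
    have h := hjoint hu hv huv h₁ h₂
    rw [← add_smul, huv, one_smul] at h
    change f _ + g z ≤ 0
    convert h using 3
    simp only [smul_eq_mul]
    linear_combination (-b) * huv
  have hlaw : ∀ (x : Fin n → ℝ) z b,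
      (stdGaussianPi n {ξ : Fin n → ℝ | f (∑ i, x i * ξ i + b) + g z ≤ 0}).toReal =
        (gaussianReal 0 1).real (S ‖WithLp.toLp 2 x‖ z b) := by
    intro x z b
    have hm : MeasurableSet {y : ℝ | f (y + b) + g z ≤ 0} :=
      (isClosed_le (by fun_prop) continuous_const).measurableSet
    have h := congrArg (fun μ : Measure ℝ => μ.real {y : ℝ | f (y + b) + g z ≤ 0})
      (stdGaussianPi_map_sum_mul x)
    beta_reduce at h
    rw [map_measureReal_apply (by fun_prop) hm, map_measureReal_apply (by fun_prop) hm] at h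
    exact h
  rintro ⟨x₁, z₁, b₁⟩ hp₁ ⟨x₂, z₂, b₂⟩ hp₂ α β hα hβ hαβ
  simp only [mem_ofPred_eq, hlaw, ge_iff_le, Prod.smul_mk, Prod.mk_add_mk] at hp₁ hp₂ ⊢
  set σ₁ := ‖WithLp.toLp 2 x₁‖
  set σ₂ := ‖WithLp.toLp 2 x₂‖
  set σ := ‖WithLp.toLp 2 (α • x₁ + β • x₂)‖
  set τ := α * σ₁ + β * σ₂ with hτ
  have hσ₁ : 0 ≤ σ₁ := norm_nonneg _
  have hσ₂ : 0 ≤ σ₂ := norm_nonneg _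
  have hσ : 0 ≤ σ := norm_nonneg _
  have hστ : σ ≤ τ := by
    refine (norm_add_le (α • WithLp.toLp 2 x₁) (β • WithLp.toLp 2 x₂)).trans_eq ?_
    rw [norm_smul, norm_smul, Real.norm_of_nonneg hα, Real.norm_of_nonneg hβ]
  have h0₁ := zero_mem_of_half_le_gaussianReal (hSclosed σ₁ z₁ b₁) (hSconv _ _ _) (by linarith)
  have h0₂ := zero_mem_of_half_le_gaussianReal (hSclosed σ₂ z₂ b₂) (hSconv _ _ _) (by linarith)
  obtain ⟨u, v, hu, hv, huv, hu₁, hv₂⟩ : ∃ u v : ℝ, 0 ≤ u ∧ 0 ≤ v ∧ u + v = 1 ∧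
      τ * u = α * σ₁ ∧ τ * v = β * σ₂ := by
    have hA : 0 ≤ α * σ₁ := by positivity
    have hB : 0 ≤ β * σ₂ := by positivity
    rcases (add_nonneg hA hB).eq_or_lt with h | h
    · exact ⟨1, 0, by norm_num, by norm_num, by norm_num, by linarith, by linarith⟩
    · refine ⟨α * σ₁ / τ, β * σ₂ / τ, by positivity, by positivity, ?_, mul_div_cancel₀ _ h.ne', mul_div_cancel₀ _ h.ne'⟩
      rw [← add_div]
      exact div_self h.ne'
  have hcomb : ∀ y₁ ∈ S σ₁ z₁ b₁, ∀ y₂ ∈ S σ₂ z₂ b₂,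
      u * y₁ + v * y₂ ∈ S τ (α • z₁ + β • z₂) (α • b₁ + β • b₂) := by
    intro y₁ hy₁ y₂ hy₂
    change f _ + g _ ≤ 0
    convert hjoint hα hβ hαβ hy₁ hy₂ using 3
    simp only [smul_eq_mul]
    linear_combination y₁ * hu₁ + y₂ * hv₂
  have hmass := gaussianReal_real_ge_of_convex_comb (hSclosed _ _ _) (hSclosed _ _ _)
    (hSconv _ _ _) (hSconv _ _ _) h0₁ h0₂ hu hv huv (hSconv _ _ _) hcomb
  have h0 : (0 : ℝ) ∈ S τ (α • z₁ + β • z₂) (α • b₁ + β • b₂) := by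
    simpa using hcomb 0 h0₁ 0 h0₂
  have hsub : S τ (α • z₁ + β • z₂) (α • b₁ + β • b₂) ⊆
      S σ (α • z₁ + β • z₂) (α • b₁ + β • b₂) := by
    intro y hy
    obtain ⟨r, hr0, hr1, hr⟩ : ∃ r : ℝ, 0 ≤ r ∧ r ≤ 1 ∧ σ = τ * r := by
      rcases (hσ.trans hστ).eq_or_lt with h | h
      · exact ⟨0, le_rfl, zero_le_one, by linarith⟩
      · exact ⟨σ / τ, by positivity, (div_le_one h).2 hστ, by field_simp⟩
    have hry := (hSconv τ (α • z₁ + β • z₂) (α • b₁ + β • b₂)).smul_mem_of_zero_mem h0 hy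
      ⟨hr0, hr1⟩
    change f _ + g _ ≤ 0 at hry ⊢
    rwa [hr, mul_assoc]
  have hmono := measureReal_mono (μ := gaussianReal 0 1) hsub
  have e₁ := mul_le_mul_of_nonneg_left hp₁ hu
  have e₂ := mul_le_mul_of_nonneg_left hp₂ hv
  have e₃ : u * (1 - ε) + v * (1 - ε) = 1 - ε := by rw [← add_mul, huv, one_mul]
  linarith
end

section
/- Let ε ∈ (0, 1). The set {(b, d, k) ∈ ℝ³ : γ({s ∈ ℝ : (s + b)² + (s + d)² ≤ k}) ≥ 1 − ε} is convex. (This is the chance constraint P((ξ+b)² + (ξ+d)² ≤ k) ≥ 1−ε for a scalar standard Gaussian random variable ξ.) -/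
open MeasureTheory ProbabilityTheory Set

/-- A twice differentiable function all of whose critical points in `(0, 1)` have negative second
derivative is bounded below on `[0, 1]` by its values at the endpoints. -/
lemma min_le_of_second_deriv_neg_at_critical {f f₁ f₂ : ℝ → ℝ}
    (hf : ∀ t, HasDerivAt f (f₁ t) t) (hf₁ : ∀ t, HasDerivAt f₁ (f₂ t) t)
    (h : ∀ t ∈ Ioo (0 : ℝ) 1, f₁ t = 0 → f₂ t < 0) {t : ℝ} (ht : t ∈ Icc (0 : ℝ) 1) :
    min (f 0) (f 1) ≤ f t := by
  have hcont : Continuous f := continuous_iff_continuousAt.2 fun t => (hf t).continuousAt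
  obtain ⟨x, hx, hmin⟩ := isCompact_Icc.exists_isMinOn ⟨t, ht⟩ hcont.continuousOn
  have hxt : f x ≤ f t := hmin ht
  rcases eq_or_lt_of_le hx.1 with h0 | h0
  · exact (min_le_left _ _).trans (h0 ▸ hxt)
  rcases eq_or_lt_of_le hx.2 with h1 | h1
  · exact (min_le_right _ _).trans (h1 ▸ hxt)
  exfalso
  have hloc : IsLocalMin f x := hmin.isLocalMin (Icc_mem_nhds h0 h1)
  have hd : deriv f = f₁ := funext fun t => (hf t).deriv
  have hcrit : f₁ x = 0 := hloc.hasDerivAt_eq_zero (hf x)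
  have hneg : deriv (deriv f) x < 0 := by
    rw [hd, (hf₁ x).deriv]
    exact h x ⟨h0, h1⟩ hcrit
  have hmax : IsLocalMax f x :=
    isLocalMax_of_deriv_deriv_neg hneg (by rw [hd, hcrit]) hcont.continuousAt
  have hconst : f =ᶠ[nhds x] fun _ => f x := by
    filter_upwards [hloc, hmax] with y hy hy'
    exact le_antisymm hy' hy
  have := hconst.deriv.deriv_eq
  simp only [deriv_const'] at this
  linarith

lemma hasDerivAt_gaussianPDFReal_zero_one (x : ℝ) :
    HasDerivAt (gaussianPDFReal 0 1) (-x * gaussianPDFReal 0 1 x) x := by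
  rw [gaussianPDFReal_def]
  have h : HasDerivAt (fun y : ℝ => -(y - 0) ^ 2 / (2 * ((1 : NNReal) : ℝ))) (-x) x := by
    refine ((((hasDerivAt_id x).sub_const 0).pow 2).neg).div_const _ |>.congr_deriv ?_
    simp
    ring
  refine (h.exp.const_mul _).congr_deriv ?_
  ring

lemma strictMono_div_gaussianPDFReal_zero_one :
    StrictMono fun x : ℝ => x / gaussianPDFReal 0 1 x := by
  have hp (x : ℝ) : 0 < gaussianPDFReal 0 1 x := gaussianPDFReal_pos 0 1 x one_ne_zero
  refine strictMono_of_hasDerivAt_pos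
    (fun x => (hasDerivAt_id x).div (hasDerivAt_gaussianPDFReal_zero_one x) (hp x).ne') fun x => ?_
  have := hp x
  have h : 0 < gaussianPDFReal 0 1 x * (1 + x ^ 2) := by positivity
  refine div_pos ?_ (by positivity)
  simp only [id]
  nlinarith

lemma hasDerivAt_integral_gaussianPDFReal (x : ℝ) :
    HasDerivAt (fun u => ∫ y in (0 : ℝ)..u, gaussianPDFReal 0 1 y) (gaussianPDFReal 0 1 x) x := by
  have hc : Continuous (gaussianPDFReal 0 1) := continuous_iff_continuousAt.2
    fun t => (hasDerivAt_gaussianPDFReal_zero_one t).continuousAt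
  exact intervalIntegral.integral_hasDerivAt_right (hc.intervalIntegrable _ _)
    (hc.stronglyMeasurableAtFilter _ _) hc.continuousAt

lemma gaussianReal_Icc_toReal {a b : ℝ} (hab : a ≤ b) :
    (gaussianReal 0 1 (Icc a b)).toReal =
      (∫ y in (0 : ℝ)..b, gaussianPDFReal 0 1 y) - ∫ y in (0 : ℝ)..a, gaussianPDFReal 0 1 y := by
  have hi := integrable_gaussianPDFReal 0 1
  rw [intervalIntegral.integral_interval_sub_left hi.intervalIntegrable hi.intervalIntegrable,
    intervalIntegral.integral_of_le hab, gaussianReal_apply_eq_integral 0 one_ne_zero,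
    integral_Icc_eq_integral_Ioc, ENNReal.toReal_ofReal]
  exact integral_nonneg (gaussianPDFReal_nonneg 0 1)

/-- The standard Gaussian measure of an interval is quasi-concave in the endpoints. -/
lemma min_le_gaussianReal_Icc {a₀ b₀ a₁ b₁ : ℝ} (h₀ : a₀ < b₀) (h₁ : a₁ < b₁) {t : ℝ}
    (ht : t ∈ Icc (0 : ℝ) 1) :
    min (gaussianReal 0 1 (Icc a₀ b₀)).toReal (gaussianReal 0 1 (Icc a₁ b₁)).toReal ≤
      (gaussianReal 0 1 (Icc (a₀ + t * (a₁ - a₀)) (b₀ + t * (b₁ - b₀)))).toReal := by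
  have hlt {s : ℝ} (hs : s ∈ Icc (0 : ℝ) 1) : a₀ + s * (a₁ - a₀) < b₀ + s * (b₁ - b₀) := by
    rcases eq_or_lt_of_le hs.1 with h | h
    · subst h
      simpa using h₀
    · nlinarith [mul_pos h (sub_pos.2 h₁), mul_nonneg (sub_nonneg.2 hs.2) (sub_pos.2 h₀).le]
  by_cases hzero : a₁ - a₀ = 0 ∧ b₁ - b₀ = 0
  · simp [hzero.1, hzero.2]
  rw [gaussianReal_Icc_toReal h₀.le, gaussianReal_Icc_toReal h₁.le,
    gaussianReal_Icc_toReal (hlt ht).le]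
  generalize hα : a₁ - a₀ = α at *
  generalize hβ : b₁ - b₀ = β at *
  set p := gaussianPDFReal 0 1 with hp_def
  have hp (x : ℝ) : 0 < p x := gaussianPDFReal_pos 0 1 x one_ne_zero
  have hline (c δ s : ℝ) : HasDerivAt (fun s : ℝ => c + s * δ) δ s := by
    simpa using ((hasDerivAt_id s).mul_const δ).const_add c
  have key := min_le_of_second_deriv_neg_at_critical
    (fun s => ((hasDerivAt_integral_gaussianPDFReal _).comp s (hline b₀ β s)).sub
      ((hasDerivAt_integral_gaussianPDFReal _).comp s (hline a₀ α s)))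
    (fun s => (((hasDerivAt_gaussianPDFReal_zero_one _).comp s (hline b₀ β s)).mul_const β).sub
      (((hasDerivAt_gaussianPDFReal_zero_one _).comp s (hline a₀ α s)).mul_const α))
    (fun s hs hcrit => ?_) ht
  · simpa [Function.comp_def, ← hα, ← hβ] using key
  · have hab := strictMono_div_gaussianPDFReal_zero_one (hlt ⟨hs.1.le, hs.2.le⟩)
    simp only [← hp_def] at hab hcrit ⊢
    generalize a₀ + s * α = a at *
    generalize b₀ + s * β = b at *
    have hpa := hp a
    have hpb := hp b
    have heq : p b * β = p a * α := sub_eq_zero.1 hcrit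
    have hα0 : α ≠ 0 := by
      rintro rfl
      exact hzero ⟨rfl, by simpa [hpb.ne'] using heq⟩
    have hK : 0 < (p a * α) ^ 2 := by positivity
    have hlt' := mul_lt_mul_of_pos_left hab hK
    have e1 : (p a * α) ^ 2 * (a / p a) = a * p a * α * α := by field_simp
    have e2 : (p a * α) ^ 2 * (b / p b) = b * p b * β * β := by
      rw [← heq]
      field_simp
    rw [e1, e2] at hlt'
    linarith

lemma exists_center_radius {b d k : ℝ}
    (h : 0 < (gaussianReal 0 1 {s : ℝ | (s + b) ^ 2 + (s + d) ^ 2 ≤ k}).toReal) :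
    ∃ r > 0, 2 * r ^ 2 + (b - d) ^ 2 / 2 = k ∧
      {s : ℝ | (s + b) ^ 2 + (s + d) ^ 2 ≤ k} = Icc (-(b + d) / 2 - r) (-(b + d) / 2 + r) := by
  have hq (s : ℝ) : (s + b) ^ 2 + (s + d) ^ 2 =
      2 * (s - -(b + d) / 2) ^ 2 + (b - d) ^ 2 / 2 := by ring
  have hpos : 0 < k - (b - d) ^ 2 / 2 := by
    by_contra! hle
    have hsub : {s : ℝ | (s + b) ^ 2 + (s + d) ^ 2 ≤ k} ⊆ {-(b + d) / 2} := by
      intro s hs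
      rw [mem_ofPred_eq, hq] at hs
      have : (s - -(b + d) / 2) ^ 2 = 0 := by nlinarith [sq_nonneg (s - -(b + d) / 2)]
      exact sub_eq_zero.1 (pow_eq_zero_iff two_ne_zero |>.1 this)
    have : gaussianReal 0 1 {-(b + d) / 2} = 0 :=
      gaussianReal_absolutelyContinuous 0 one_ne_zero (measure_singleton _)
    rw [measure_mono_null hsub this] at h
    simp at h
  have hsq := Real.sq_sqrt (show 0 ≤ (k - (b - d) ^ 2 / 2) / 2 by linarith)
  have hr : 0 < √((k - (b - d) ^ 2 / 2) / 2) := Real.sqrt_pos.2 (by linarith)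
  generalize √((k - (b - d) ^ 2 / 2) / 2) = r at hsq hr
  refine ⟨r, hr, by linarith, ?_⟩
  ext s
  rw [mem_ofPred_eq, hq, mem_Icc]
  have : 2 * (s - -(b + d) / 2) ^ 2 + (b - d) ^ 2 / 2 ≤ k ↔ (s - -(b + d) / 2) ^ 2 ≤ r ^ 2 := by
    constructor <;> intro <;> linarith
  rw [this, sq_le_sq, abs_of_pos hr, abs_le]
  constructor <;> rintro ⟨h1, h2⟩ <;> constructor <;> linarith

/-- The chance constraint set `{(b,d,k) : P((ξ+b)² + (ξ+d)² ≤ k) ≥ 1 − ε}` for a scalar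
standard Gaussian `ξ` is convex, for every `ε ∈ (0,1)`. -/
theorem stmt9 (ε : ℝ) (hε : ε ∈ Set.Ioo (0 : ℝ) 1) :
    Convex ℝ {p : ℝ × ℝ × ℝ |
      ((gaussianReal 0 1) {s : ℝ |
        (s + p.1) ^ 2 + (s + p.2.1) ^ 2 ≤ p.2.2}).toReal ≥ 1 - ε} := by
  rintro ⟨b₀, d₀, k₀⟩ h₀ ⟨b₁, d₁, k₁⟩ h₁ u t hu ht hut
  obtain rfl : u = 1 - t := by linarith
  simp only [mem_ofPred_eq, ge_iff_le, Prod.smul_mk, Prod.mk_add_mk, smul_eq_mul] at h₀ h₁ ⊢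
  obtain ⟨r₀, hr₀, hk₀, hs₀⟩ := exists_center_radius (lt_of_lt_of_le (by linarith [hε.2]) h₀)
  obtain ⟨r₁, hr₁, hk₁, hs₁⟩ := exists_center_radius (lt_of_lt_of_le (by linarith [hε.2]) h₁)
  rw [hs₀] at h₀
  rw [hs₁] at h₁
  refine (le_min h₀ h₁).trans ((min_le_gaussianReal_Icc (by linarith) (by linarith)
    ⟨ht, by linarith⟩).trans (ENNReal.toReal_mono (measure_ne_top _ _) (measure_mono ?_)))
  rintro s ⟨hl, hr⟩
  have hsq : (s - -(((1 - t) * b₀ + t * b₁) + ((1 - t) * d₀ + t * d₁)) / 2) ^ 2 ≤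
      ((1 - t) * r₀ + t * r₁) ^ 2 :=
    sq_le_sq' (by linarith) (by linarith)
  have hr_conv : 0 ≤ (1 - t) * t * (r₀ - r₁) ^ 2 := by positivity
  have hδ_conv : 0 ≤ (1 - t) * t * ((b₀ - d₀) - (b₁ - d₁)) ^ 2 := by positivity
  rw [mem_ofPred_eq, ← hk₀, ← hk₁]
  linarith
end

section
/- For every ε ∈ (0, 1/2], one has q(1 − ε/2) − q(1 − ε) ≥ q(1 − ε/4) − q(1 − ε/2). -/
open MeasureTheory ProbabilityTheory Set

/-- The Gaussian measure of a translate, as an integral over the original set. -/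
theorem gaussianReal_preimage_sub (h : ℝ) {s : Set ℝ} (hs : MeasurableSet s) :
    gaussianReal 0 1 ((fun x => x - h) ⁻¹' s) = ∫⁻ x in s, gaussianPDF 0 1 (x + h) := by
  rw [gaussianReal_apply 0 one_ne_zero]
  have := (measurePreserving_sub_right (volume : Measure ℝ) h).setLIntegral_comp_preimage hs
    (f := fun x => gaussianPDF 0 1 (x + h)) (by fun_prop)
  simpa using this

theorem gaussianPDF_add (x h : ℝ) :
    gaussianPDF 0 1 (x + h) = ENNReal.ofReal (Real.exp (-(x * h) - h ^ 2 / 2)) *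
      gaussianPDF 0 1 x := by
  rw [gaussianPDF, gaussianPDF, ← ENNReal.ofReal_mul (Real.exp_pos _).le, gaussianPDFReal,
    gaussianPDFReal, mul_left_comm, ← Real.exp_add]
  congr 3
  simp
  ring

theorem gaussianReal_Ioi_add_le (b : ℝ) {h : ℝ} (hh : 0 ≤ h) :
    (gaussianReal 0 1).real (Ioi (b + h)) ≤
      Real.exp (-(b * h) - h ^ 2 / 2) * (gaussianReal 0 1).real (Ioi b) := by
  have key : gaussianReal 0 1 (Ioi (b + h)) ≤
      ENNReal.ofReal (Real.exp (-(b * h) - h ^ 2 / 2)) * gaussianReal 0 1 (Ioi b) := by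
    have e : Ioi (b + h) = (fun x => x - h) ⁻¹' Ioi b := by ext; simp
    rw [e, gaussianReal_preimage_sub h measurableSet_Ioi, gaussianReal_apply 0 one_ne_zero,
      ← lintegral_const_mul _ (by fun_prop)]
    refine setLIntegral_mono (by fun_prop) fun x hx => ?_
    rw [gaussianPDF_add]
    gcongr
    exact (mem_Ioi.1 hx).le
  have := ENNReal.toReal_mono (by finiteness) key
  rwa [ENNReal.toReal_mul, ENNReal.toReal_ofReal (Real.exp_pos _).le] at this

theorem le_gaussianReal_Ioc_add (a b : ℝ) {h : ℝ} (hh : 0 ≤ h) :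
    Real.exp (-(b * h) - h ^ 2 / 2) * (gaussianReal 0 1).real (Ioc a b) ≤
      (gaussianReal 0 1).real (Ioc (a + h) (b + h)) := by
  have key : ENNReal.ofReal (Real.exp (-(b * h) - h ^ 2 / 2)) * gaussianReal 0 1 (Ioc a b) ≤
      gaussianReal 0 1 (Ioc (a + h) (b + h)) := by
    have e : Ioc (a + h) (b + h) = (fun x => x - h) ⁻¹' Ioc a b := by
      ext; simp
    rw [e, gaussianReal_preimage_sub h measurableSet_Ioc, gaussianReal_apply 0 one_ne_zero,
      ← lintegral_const_mul _ (by fun_prop)]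
    refine setLIntegral_mono (by fun_prop) fun x hx => ?_
    rw [gaussianPDF_add]
    gcongr
    exact hx.2
  have := ENNReal.toReal_mono (by finiteness) key
  rwa [ENNReal.toReal_mul, ENNReal.toReal_ofReal (Real.exp_pos _).le] at this

theorem gaussianReal_Ioi_eq_one_sub_Phi (t : ℝ) :
    (gaussianReal 0 1).real (Ioi t) = 1 - Phi t := by
  rw [← compl_Iic, probReal_compl_eq_one_sub measurableSet_Iic]
  rfl

theorem gaussianReal_Ioc_eq_Phi_sub {s t : ℝ} (hst : s ≤ t) :
    (gaussianReal 0 1).real (Ioc s t) = Phi t - Phi s := by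
  have e : Ioc s t = Iic t \ Iic s := by ext; simp [and_comm]
  rw [e, measureReal_sdiff (Iic_subset_Iic.2 hst) measurableSet_Iic]
  rfl

theorem Phi_strictMono : StrictMono Phi := by
  intro s t hst
  rw [← sub_pos, ← gaussianReal_Ioc_eq_Phi_sub hst.le]
  refine ENNReal.toReal_pos (fun h0 => ?_) (by finiteness)
  have := gaussianReal_absolutelyContinuous' 0 one_ne_zero h0
  simp at this
  linarith

/-- Midpoint log-concavity of the Gaussian tail. -/
theorem one_sub_Phi_mul_le_sq (a : ℝ) {h : ℝ} (hh : 0 ≤ h) :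
    (1 - Phi a) * (1 - Phi (a + h + h)) ≤ (1 - Phi (a + h)) ^ 2 := by
  have h1 := gaussianReal_Ioi_add_le (a + h) hh
  have h2 := le_gaussianReal_Ioc_add a (a + h) hh
  rw [gaussianReal_Ioi_eq_one_sub_Phi, gaussianReal_Ioi_eq_one_sub_Phi] at h1
  rw [gaussianReal_Ioc_eq_Phi_sub (by linarith), gaussianReal_Ioc_eq_Phi_sub (by linarith)] at h2
  have hA : 0 ≤ Phi (a + h) - Phi a := sub_nonneg.2 (Phi_strictMono.monotone (by linarith))
  have hQ : 0 ≤ 1 - Phi (a + h) := by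
    rw [← gaussianReal_Ioi_eq_one_sub_Phi]; exact measureReal_nonneg
  nlinarith [mul_le_mul_of_nonneg_left h1 hA, mul_le_mul_of_nonneg_left h2 hQ]

/-- For every `ε ∈ (0,1/2]`, `q(1−ε/2) − q(1−ε) ≥ q(1−ε/4) − q(1−ε/2)`, where `q` is the
standard Gaussian quantile function. -/
theorem stmt13 (q : ℝ → ℝ) (hq : ∀ p ∈ Set.Ioo (0 : ℝ) 1, Phi (q p) = p)
    (ε : ℝ) (hε0 : 0 < ε) (hε : ε ≤ 1 / 2) :
    q (1 - ε / 2) - q (1 - ε) ≥ q (1 - ε / 4) - q (1 - ε / 2) := by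
  have ha := hq (1 - ε) ⟨by linarith, by linarith⟩
  have hb := hq (1 - ε / 2) ⟨by linarith, by linarith⟩
  have hc := hq (1 - ε / 4) ⟨by linarith, by linarith⟩
  have hab : q (1 - ε) < q (1 - ε / 2) := Phi_strictMono.lt_iff_lt.1 (by linarith)
  by_contra! hlt
  have hconc := one_sub_Phi_mul_le_sq (q (1 - ε)) (sub_nonneg.2 hab.le)
  have hstrict := Phi_strictMono (show q (1 - ε) + (q (1 - ε / 2) - q (1 - ε)) +
    (q (1 - ε / 2) - q (1 - ε)) < q (1 - ε / 4) by linarith)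
  rw [add_sub_cancel] at hconc hstrict
  rw [ha, hb] at hconc
  rw [hc] at hstrict
  nlinarith [mul_lt_mul_of_pos_left hstrict hε0]
end
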